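/- The polynomial 82796609536z¹⁰ − 125942890496z⁹ − 278408523776z⁸ + 430685329920z⁷ + 381960569664z⁶ − 519574865472z⁵ − 253658186064z⁴ + 253489557672z³ + 78314553945z² − 51532664454z + 1113912729 is irreducible over ℚ and has exactly one root ρ in the interval (1/4, 1/2), with 0.415 < ρ < 0.4151. -/

import Mathlib

open Polynomial

/-- The degree-10 polynomial whose root in `(1/4, 1/2)` is the radius of
convergence of the generating function of rooted 3-connected bipartite planar
maps. -/
noncomputable def rhoPoly : ℚ[X] :=
  82796609536 * X ^ 10 - 125942890496 * X ^ 9 - 278408523776 * X ^ 8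
    + 430685329920 * X ^ 7 + 381960569664 * X ^ 6 - 519574865472 * X ^ 5
    - 253658186064 * X ^ 4 + 253489557672 * X ^ 3 + 78314553945 * X ^ 2
    - 51532664454 * X + 1113912729


theorem aux_key {K : Type*} [Field K] (a : K) (h7 : (7:K) = 0)
    (hf : 6 + 2*a + 5*a^2 + 1*a^3 + 4*a^4 + 2*a^5 + 2*a^6 + 6*a^7 + 2*a^8 + 4*a^9 + 4*a^10 = 0)
    (d : ℕ) (h1 : 1 ≤ d) (h5 : d ≤ 5) (hd : a^(7^d) = a) : False := by
  have y1 : a^(7^1) = 1*a^7 := by norm_num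
  have z2_2 : (1*a^7)*(1*a^7) = 1 + 2*a + 2*a^2 + 3*a^3 + 1*a^5 + 6*a^6 + 4*a^7 + 3*a^8 + 3*a^9 := by
    linear_combination (1 + 4*a + 1*a^2 + 5*a^3 + 2*a^4)*hf + (-1 + -4*a + -3*a^2 + -8*a^3 + -5*a^4 + -7*a^5 + -5*a^6 + -6*a^7 + -7*a^8 + -5*a^9 + -8*a^10 + -6*a^11 + -4*a^12 + -4*a^13 + -1*a^14)*h7
  have z2_4 : (1 + 2*a + 2*a^2 + 3*a^3 + 1*a^5 + 6*a^6 + 4*a^7 + 3*a^8 + 3*a^9)*(1 + 2*a + 2*a^2 + 3*a^3 + 1*a^5 + 6*a^6 + 4*a^7 + 3*a^8 + 3*a^9) = 6 + 4*a + 5*a^2 + 5*a^3 + 4*a^4 + 6*a^6 + 2*a^7 + 4*a^8 + 3*a^9 := by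
    linear_combination (5 + 3*a + 4*a^3 + 5*a^4 + 3*a^5 + 4*a^6 + 4*a^7 + 4*a^8)*hf + (-5 + -4*a + -4*a^2 + -5*a^3 + -7*a^4 + -8*a^5 + -8*a^6 + -10*a^7 + -9*a^8 + -3*a^9 + -9*a^10 + -6*a^11 + -2*a^12 + -4*a^13 + -2*a^14 + -1*a^16 + -2*a^17 + -1*a^18)*h7
  have z2_6 : (6 + 4*a + 5*a^2 + 5*a^3 + 4*a^4 + 6*a^6 + 2*a^7 + 4*a^8 + 3*a^9)*(1 + 2*a + 2*a^2 + 3*a^3 + 1*a^5 + 6*a^6 + 4*a^7 + 3*a^8 + 3*a^9) = 6 + 2*a + 6*a^2 + 1*a^3 + 1*a^4 + 6*a^5 + 5*a^6 + 1*a^7 + 1*a^8 + 2*a^9 := by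
    linear_combination (2*a^2 + 6*a^3 + 1*a^4 + 1*a^5 + 6*a^6 + 3*a^7 + 4*a^8)*hf + (2*a + 1*a^2 + 1*a^4 + -1*a^5 + 1*a^6 + 2*a^7 + 1*a^8 + 8*a^9 + 2*a^11 + -4*a^13 + 1*a^14 + -2*a^16 + -1*a^17 + -1*a^18)*h7
  have z2_7 : (6 + 2*a + 6*a^2 + 1*a^3 + 1*a^4 + 6*a^5 + 5*a^6 + 1*a^7 + 1*a^8 + 2*a^9)*(1*a^7) = 5 + 2*a + 2*a^2 + 4*a^3 + 3*a^4 + 3*a^5 + 2*a^6 + 6*a^7 + 3*a^8 := by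
    linear_combination (5 + 5*a + 2*a^2 + 3*a^3 + 2*a^4 + 5*a^5 + 4*a^6)*hf + (-5 + -6*a + -7*a^2 + -8*a^3 + -8*a^4 + -12*a^5 + -11*a^6 + -13*a^7 + -12*a^8 + -10*a^9 + -13*a^10 + -9*a^11 + -8*a^12 + -7*a^13 + -5*a^14 + -5*a^15 + -2*a^16)*h7
  have y2 : a^(7^2) = 5 + 2*a + 2*a^2 + 4*a^3 + 3*a^4 + 3*a^5 + 2*a^6 + 6*a^7 + 3*a^8 := by
    rw [show a^(7^2) = (((a^(7^1))*(a^(7^1)))*((a^(7^1))*(a^(7^1))))*((a^(7^1))*(a^(7^1)))*(a^(7^1)) by simp only [← pow_add]; norm_num, y1, z2_2, z2_4, z2_6, z2_7]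
  have z3_2 : (5 + 2*a + 2*a^2 + 4*a^3 + 3*a^4 + 3*a^5 + 2*a^6 + 6*a^7 + 3*a^8)*(5 + 2*a + 2*a^2 + 4*a^3 + 3*a^4 + 3*a^5 + 2*a^6 + 6*a^7 + 3*a^8) = 1 + 2*a^2 + 6*a^3 + 5*a^4 + 1*a^5 + 5*a^6 + 4*a^7 + 4*a^8 + 3*a^9 := by
    linear_combination (4 + 2*a + 2*a^2 + 4*a^3 + 5*a^4 + 5*a^5 + 4*a^6)*hf + (-2*a^2 + -3*a^4 + -3*a^5 + -4*a^6 + 2*a^7 + 2*a^8 + -1*a^9 + -1*a^10 + -2*a^12 + -4*a^13 + -1*a^16)*h7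
  have z3_4 : (1 + 2*a^2 + 6*a^3 + 5*a^4 + 1*a^5 + 5*a^6 + 4*a^7 + 4*a^8 + 3*a^9)*(1 + 2*a^2 + 6*a^3 + 5*a^4 + 1*a^5 + 5*a^6 + 4*a^7 + 4*a^8 + 3*a^9) = 2 + 1*a + 3*a^2 + 5*a^4 + 4*a^5 + 5*a^6 + 4*a^7 + 5*a^8 := by
    linear_combination (1 + 3*a + 3*a^2 + 3*a^3 + 5*a^4 + 6*a^5 + 6*a^6 + 2*a^7 + 4*a^8)*hf + (-1 + -3*a + -4*a^2 + -4*a^3 + -7*a^4 + -8*a^5 + -5*a^6 + -3*a^7 + -8*a^8 + 1*a^10 + 2*a^11 + 1*a^12 + -2*a^13 + -2*a^14 + -2*a^15 + -1*a^18)*h7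
  have z3_6 : (2 + 1*a + 3*a^2 + 5*a^4 + 4*a^5 + 5*a^6 + 4*a^7 + 5*a^8)*(1 + 2*a^2 + 6*a^3 + 5*a^4 + 1*a^5 + 5*a^6 + 4*a^7 + 4*a^8 + 3*a^9) = 1 + 5*a + 1*a^2 + 2*a^3 + 3*a^4 + 1*a^5 + 4*a^6 + 4*a^7 + 2*a^8 + 4*a^9 := by
    linear_combination (6 + 2*a + 4*a^3 + 3*a^4 + 4*a^5 + 6*a^6 + 2*a^7)*hf + (-5 + -4*a + -4*a^2 + -4*a^3 + -4*a^4 + -6*a^5 + -6*a^6 + -7*a^7 + 1*a^8 + 1*a^9 + 1*a^10 + 6*a^11 + 4*a^12 + 3*a^14 + 1*a^15 + 1*a^17)*h7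
  have z3_7 : (1 + 5*a + 1*a^2 + 2*a^3 + 3*a^4 + 1*a^5 + 4*a^6 + 4*a^7 + 2*a^8 + 4*a^9)*(5 + 2*a + 2*a^2 + 4*a^3 + 3*a^4 + 3*a^5 + 2*a^6 + 6*a^7 + 3*a^8) = 3*a + 1*a^2 + 4*a^3 + 2*a^4 + 5*a^5 + 5*a^7 + 3*a^8 + 4*a^9 := by
    linear_combination (2 + 1*a + 3*a^2 + 5*a^3 + 6*a^4 + 2*a^5 + 1*a^6 + 3*a^7)*hf + (-1 + 2*a + -2*a^2 + -3*a^3 + -4*a^4 + -4*a^5 + -1*a^6 + -2*a^7 + 2*a^8 + 1*a^9 + -1*a^10 + -2*a^11 + -1*a^12 + -1*a^13 + 2*a^15 + 2*a^16)*h7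
  have y3 : a^(7^3) = 3*a + 1*a^2 + 4*a^3 + 2*a^4 + 5*a^5 + 5*a^7 + 3*a^8 + 4*a^9 := by
    rw [show a^(7^3) = (((a^(7^2))*(a^(7^2)))*((a^(7^2))*(a^(7^2))))*((a^(7^2))*(a^(7^2)))*(a^(7^2)) by simp only [← pow_add]; norm_num, y2, z3_2, z3_4, z3_6, z3_7]
  have z4_2 : (3*a + 1*a^2 + 4*a^3 + 2*a^4 + 5*a^5 + 5*a^7 + 3*a^8 + 4*a^9)*(3*a + 1*a^2 + 4*a^3 + 2*a^4 + 5*a^5 + 5*a^7 + 3*a^8 + 4*a^9) = 4 + 2*a + 2*a^2 + 5*a^3 + 2*a^4 + 3*a^5 + 3*a^6 + 5*a^7 + 1*a^8 + 6*a^9 := by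
    linear_combination (4 + 3*a + 5*a^2 + 1*a^5 + 3*a^6 + 2*a^7 + 4*a^8)*hf + (-4 + -4*a + -7*a^2 + -4*a^3 + -3*a^4 + -2*a^5 + -1*a^6 + -6*a^7 + -1*a^8 + -5*a^9 + 3*a^10 + 6*a^12 + 2*a^13 + 5*a^14 + -2*a^15 + 3*a^16)*h7
  have z4_4 : (4 + 2*a + 2*a^2 + 5*a^3 + 2*a^4 + 3*a^5 + 3*a^6 + 5*a^7 + 1*a^8 + 6*a^9)*(4 + 2*a + 2*a^2 + 5*a^3 + 2*a^4 + 3*a^5 + 3*a^6 + 5*a^7 + 1*a^8 + 6*a^9) = 2 + 6*a + 6*a^2 + 5*a^3 + 1*a^4 + 4*a^5 + 5*a^6 + 5*a^7 + 2*a^8 + 3*a^9 := by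
    linear_combination (4*a + 1*a^2 + 5*a^4 + 1*a^6 + 1*a^7 + 2*a^8)*hf + (2 + -2*a + 3*a^3 + 3*a^5 + 3*a^6 + 8*a^7 + 1*a^8 + 11*a^9 + 8*a^10 + 2*a^11 + 11*a^12 + 4*a^13 + 5*a^14 + 4*a^15 + 7*a^16 + 4*a^18)*h7
  have z4_6 : (2 + 6*a + 6*a^2 + 5*a^3 + 1*a^4 + 4*a^5 + 5*a^6 + 5*a^7 + 2*a^8 + 3*a^9)*(4 + 2*a + 2*a^2 + 5*a^3 + 2*a^4 + 3*a^5 + 3*a^6 + 5*a^7 + 1*a^8 + 6*a^9) = 4 + 6*a^3 + 1*a^4 + 6*a^5 + 6*a^6 + 3*a^7 + 1*a^8 + 4*a^9 := by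
    linear_combination (3 + 6*a + 1*a^2 + 1*a^3 + 1*a^4 + 3*a^5 + 5*a^6 + 1*a^7 + 1*a^8)*hf + (-2 + -2*a + 1*a^2 + 1*a^3 + 4*a^4 + 2*a^5 + 3*a^6 + 4*a^7 + 4*a^8 + 9*a^9 + 7*a^10 + 6*a^11 + 8*a^12 + 2*a^13 + 5*a^14 + 2*a^15 + 3*a^16 + 1*a^17 + 2*a^18)*h7
  have z4_7 : (4 + 6*a^3 + 1*a^4 + 6*a^5 + 6*a^6 + 3*a^7 + 1*a^8 + 4*a^9)*(3*a + 1*a^2 + 4*a^3 + 2*a^4 + 5*a^5 + 5*a^7 + 3*a^8 + 4*a^9) = 2*a + 2*a^3 + 6*a^4 + 3*a^5 + 6*a^7 + 5*a^8 + 2*a^9 := by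
    linear_combination (4*a + 4*a^2 + 4*a^4 + 2*a^5 + 5*a^6 + 4*a^8)*hf + (-2*a + -4*a^2 + -2*a^3 + -4*a^4 + -2*a^5 + -5*a^6 + 2*a^7 + -3*a^8 + 3*a^10 + -1*a^11 + 4*a^12 + 1*a^13 + 5*a^14 + -2*a^15 + 1*a^16)*h7
  have y4 : a^(7^4) = 2*a + 2*a^3 + 6*a^4 + 3*a^5 + 6*a^7 + 5*a^8 + 2*a^9 := by
    rw [show a^(7^4) = (((a^(7^3))*(a^(7^3)))*((a^(7^3))*(a^(7^3))))*((a^(7^3))*(a^(7^3)))*(a^(7^3)) by simp only [← pow_add]; norm_num, y3, z4_2, z4_4, z4_6, z4_7]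
  have z5_2 : (2*a + 2*a^3 + 6*a^4 + 3*a^5 + 6*a^7 + 5*a^8 + 2*a^9)*(2*a + 2*a^3 + 6*a^4 + 3*a^5 + 6*a^7 + 5*a^8 + 2*a^9) = 4 + 1*a^3 + 2*a^4 + 3*a^5 + 3*a^6 + 1*a^7 + 1*a^8 + 4*a^9 := by
    linear_combination (4 + 1*a + 4*a^2 + 4*a^3 + 4*a^4 + 2*a^5 + 6*a^6 + 4*a^7 + 1*a^8)*hf + (-4 + -2*a + -6*a^2 + -6*a^3 + -9*a^4 + -5*a^5 + -11*a^6 + -11*a^7 + -3*a^8 + -6*a^9 + -8*a^10 + 1*a^11 + 4*a^12 + -4*a^13 + -2*a^14 + 2*a^15 + 1*a^16)*h7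
  have z5_4 : (4 + 1*a^3 + 2*a^4 + 3*a^5 + 3*a^6 + 1*a^7 + 1*a^8 + 4*a^9)*(4 + 1*a^3 + 2*a^4 + 3*a^5 + 3*a^6 + 1*a^7 + 1*a^8 + 4*a^9) = 5 + 6*a + 4*a^2 + 5*a^3 + 2*a^5 + 2*a^6 + 2*a^7 + 2*a^8 + 3*a^9 := by
    linear_combination (3 + 5*a + 1*a^2 + 6*a^3 + 4*a^4 + 1*a^5 + 4*a^6 + 5*a^7 + 4*a^8)*hf + (-1 + -6*a + -5*a^2 + -9*a^3 + -6*a^4 + -7*a^5 + -7*a^6 + -13*a^7 + -15*a^8 + -6*a^9 + -14*a^10 + -10*a^11 + -7*a^12 + -8*a^13 + -5*a^14 + -4*a^15 + -5*a^16 + -4*a^17)*h7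
  have z5_6 : (5 + 6*a + 4*a^2 + 5*a^3 + 2*a^5 + 2*a^6 + 2*a^7 + 2*a^8 + 3*a^9)*(4 + 1*a^3 + 2*a^4 + 3*a^5 + 3*a^6 + 1*a^7 + 1*a^8 + 4*a^9) = 2 + 2*a + 2*a^2 + 2*a^3 + 6*a^4 + 4*a^5 + 2*a^6 + 3*a^8 := by
    linear_combination (3 + 5*a + 4*a^2 + 6*a^3 + 4*a^4 + 5*a^5 + 2*a^6 + 5*a^7 + 3*a^8)*hf + (-2*a + -5*a^2 + -7*a^3 + -9*a^4 + -9*a^5 + -4*a^6 + -10*a^7 + -10*a^8 + -8*a^9 + -11*a^10 + -10*a^11 + -9*a^12 + -8*a^13 + -7*a^14 + -5*a^15 + -3*a^16 + -3*a^17)*h7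
  have z5_7 : (2 + 2*a + 2*a^2 + 2*a^3 + 6*a^4 + 4*a^5 + 2*a^6 + 3*a^8)*(2*a + 2*a^3 + 6*a^4 + 3*a^5 + 6*a^7 + 5*a^8 + 2*a^9) = 3 + 4*a + 5*a^2 + 4*a^4 + 5*a^5 + 6*a^6 + 6*a^7 + 2*a^8 + 1*a^9 := by
    linear_combination (3 + 6*a + 4*a^3 + 3*a^4 + 6*a^5 + 4*a^6 + 5*a^7)*hf + (-3 + -6*a + -4*a^2 + -7*a^3 + -4*a^4 + -9*a^5 + -7*a^6 + -11*a^7 + -4*a^8 + -2*a^9 + -7*a^10 + -4*a^11 + -3*a^13 + -8*a^14 + -4*a^15 + -3*a^16 + -2*a^17)*h7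
  have y5 : a^(7^5) = 3 + 4*a + 5*a^2 + 4*a^4 + 5*a^5 + 6*a^6 + 6*a^7 + 2*a^8 + 1*a^9 := by
    rw [show a^(7^5) = (((a^(7^4))*(a^(7^4)))*((a^(7^4))*(a^(7^4))))*((a^(7^4))*(a^(7^4)))*(a^(7^4)) by simp only [← pow_add]; norm_num, y4, z5_2, z5_4, z5_6, z5_7]
  interval_cases d
  · rw [y1] at hd
    have hb : (6*a + 6*a^2 + 4*a^3 + 3*a^4 + 2*a^5 + 6*a^6 + 4*a^7 + 5*a^8 + 6*a^9)*(6*a + 1*a^7) = 1 := by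
      linear_combination (1 + 2*a + 1*a^2 + 5*a^3 + 4*a^4 + 5*a^5 + 5*a^6)*hf + (-1 + -2*a + 3*a^2 + -1*a^3 + -3*a^4 + -8*a^5 + -9*a^6 + -5*a^7 + -6*a^8 + -3*a^9 + -6*a^10 + -9*a^11 + -10*a^12 + -10*a^13 + -6*a^14 + -5*a^15 + -2*a^16)*h7
    have hr : 6*a + 1*a^7 = 0 := by
      linear_combination hd + a*h7
    rw [hr, mul_zero] at hb
    exact zero_ne_one hb
  · rw [y2] at hd
    have hb : (3 + 3*a + 1*a^4 + 3*a^5 + 3*a^6 + 6*a^7 + 1*a^8)*(5 + 1*a + 2*a^2 + 4*a^3 + 3*a^4 + 3*a^5 + 2*a^6 + 6*a^7 + 3*a^8) = 1 := by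
      linear_combination (3*a + 4*a^2 + 5*a^3 + 6*a^6)*hf + (2 + -3*a^2 + -5*a^3 + -1*a^4 + -1*a^5 + -4*a^6 + 3*a^7 + -1*a^8 + -4*a^10 + -1*a^11 + -2*a^13 + 5*a^14 + -3*a^16)*h7
    have hr : 5 + 1*a + 2*a^2 + 4*a^3 + 3*a^4 + 3*a^5 + 2*a^6 + 6*a^7 + 3*a^8 = 0 := by
      linear_combination hd
    rw [hr, mul_zero] at hb
    exact zero_ne_one hb
  · rw [y3] at hd
    have hb : (6 + 6*a + 4*a^2 + 4*a^4 + 5*a^5 + 4*a^6 + 6*a^7 + 5*a^8 + 3*a^9)*(2*a + 1*a^2 + 4*a^3 + 2*a^4 + 5*a^5 + 5*a^7 + 3*a^8 + 4*a^9) = 1 := by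
      linear_combination (1 + 4*a + 2*a^2 + 1*a^3 + 1*a^4 + 3*a^5 + 6*a^6 + 6*a^7 + 3*a^8)*hf + (-1 + -2*a + -1*a^2 + 1*a^3 + 2*a^4 + 3*a^5 + -2*a^6 + -1*a^7 + -1*a^8 + 6*a^9 + 3*a^10 + 2*a^11 + 3*a^12 + 2*a^13 + 1*a^14 + -1*a^15 + -1*a^17)*h7
    have hr : 2*a + 1*a^2 + 4*a^3 + 2*a^4 + 5*a^5 + 5*a^7 + 3*a^8 + 4*a^9 = 0 := by
      linear_combination hd
    rw [hr, mul_zero] at hb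
    exact zero_ne_one hb
  · rw [y4] at hd
    have hb : (6*a + 3*a^2 + 1*a^3 + 5*a^4 + 3*a^5 + 4*a^6 + 3*a^7 + 4*a^8 + 2*a^9)*(1*a + 2*a^3 + 6*a^4 + 3*a^5 + 6*a^7 + 5*a^8 + 2*a^9) = 1 := by
      linear_combination (1 + 2*a + 3*a^2 + 1*a^4 + 3*a^5 + 2*a^6 + 1*a^8)*hf + (-1 + -2*a + -3*a^2 + -2*a^3 + -2*a^4 + 2*a^5 + -1*a^7 + 5*a^8 + 7*a^9 + 5*a^10 + 6*a^11 + 6*a^12 + 7*a^13 + 4*a^14 + 3*a^15 + 4*a^16 + 2*a^17)*h7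
    have hr : 1*a + 2*a^3 + 6*a^4 + 3*a^5 + 6*a^7 + 5*a^8 + 2*a^9 = 0 := by
      linear_combination hd
    rw [hr, mul_zero] at hb
    exact zero_ne_one hb
  · rw [y5] at hd
    have hb : (5 + 1*a + 6*a^2 + 4*a^3 + 4*a^4 + 6*a^5 + 5*a^6 + 1*a^7 + 4*a^8 + 1*a^9)*(3 + 3*a + 5*a^2 + 4*a^4 + 5*a^5 + 6*a^6 + 6*a^7 + 2*a^8 + 1*a^9) = 1 := by
      linear_combination (3*a + 2*a^2 + 5*a^3 + 5*a^4 + 5*a^5 + 5*a^6 + 3*a^7 + 2*a^8)*hf + (2 + 4*a^2 + -2*a^3 + 3*a^4 + 4*a^6 + 6*a^7 + 4*a^8 + 7*a^9 + 5*a^10 + 2*a^11 + 1*a^12 + -2*a^13 + -3*a^14 + -3*a^15 + -3*a^16 + -2*a^17 + -1*a^18)*h7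
    have hr : 3 + 3*a + 5*a^2 + 4*a^4 + 5*a^5 + 6*a^6 + 6*a^7 + 2*a^8 + 1*a^9 = 0 := by
      linear_combination hd
    rw [hr, mul_zero] at hb
    exact zero_ne_one hb

theorem aux_deriv_pos (x : ℝ) (h1 : 1/4 < x) (h2 : x < 1/2) :
    0 < (-51532664454)*x^0 + (156629107890)*x^1 + (760468673016)*x^2 + (-1014632744256)*x^3 + (-2597874327360)*x^4 + (2291763417984)*x^5 + (3014797309440)*x^6 + (-2227268190208)*x^7 + (-1133486014464)*x^8 + (827966095360)*x^9 := by
  have e : (-51532664454)*x^0 + (156629107890)*x^1 + (760468673016)*x^2 + (-1014632744256)*x^3 + (-2597874327360)*x^4 + (2291763417984)*x^5 + (3014797309440)*x^6 + (-2227268190208)*x^7 + (-1133486014464)*x^8 + (827966095360)*x^9 =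
    11976327228*((4*x-1)^0*(2-4*x)^9) + 1347160298353/8*((4*x-1)^1*(2-4*x)^8) + 7082311134875/8*((4*x-1)^2*(2-4*x)^7) + 19705338007203/8*((4*x-1)^3*(2-4*x)^6) + 32924430141217/8*((4*x-1)^4*(2-4*x)^5) + 8679929601551/2*((4*x-1)^5*(2-4*x)^4) + 5812462810365/2*((4*x-1)^6*(2-4*x)^3) + 2387854372231/2*((4*x-1)^7*(2-4*x)^2) + 545232535097/2*((4*x-1)^8*(2-4*x)^1) + 26215542825*((4*x-1)^9*(2-4*x)^0) := by ring
  have u : 0 < 4*x-1 := by linarith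
  have v : 0 < 2-4*x := by linarith
  rw [e]
  positivity

noncomputable def rhoZ : ℤ[X] := C (1113912729) * X^0 + C (-51532664454) * X^1 + C (78314553945) * X^2 + C (253489557672) * X^3 + C (-253658186064) * X^4 + C (-519574865472) * X^5 + C (381960569664) * X^6 + C (430685329920) * X^7 + C (-278408523776) * X^8 + C (-125942890496) * X^9 + C (82796609536) * X^10

theorem rhoZ_map : rhoZ.map (Int.castRingHom ℚ) = rhoPoly := by
  simp [rhoZ, rhoPoly]
  ring

theorem rhoZ_natDegree : rhoZ.natDegree = 10 := by
  unfold rhoZ; compute_degree!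

theorem rhoZ_lead : rhoZ.leadingCoeff = 82796609536 := by
  rw [leadingCoeff, rhoZ_natDegree, rhoZ]; simp [coeff_X, coeff_C]

theorem rhoZ_zero : rhoZ.coeff 0 = 1113912729 := by
  rw [rhoZ]; simp [coeff_X, coeff_C]

theorem rhoZ_prim : rhoZ.IsPrimitive := by
  intro r hr
  rw [C_dvd_iff_dvd_coeff] at hr
  have h0 := hr 0
  have h1 := hr rhoZ.natDegree
  rw [coeff_natDegree, rhoZ_lead] at h1
  rw [rhoZ_zero] at h0
  have := Int.dvd_coe_gcd h0 h1
  norm_num at this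
  exact isUnit_of_dvd_one this

instance fact7 : Fact (Nat.Prime 7) := ⟨by norm_num⟩

theorem aux_irr (g : (ZMod 7)[X]) (hg : Irreducible g)
    (hdvd : g ∣ rhoZ.map (Int.castRingHom (ZMod 7))) : 5 < g.natDegree := by
  by_contra! h5
  haveI : Fact (Irreducible g) := ⟨hg⟩
  have h1 : 1 ≤ g.natDegree := hg.natDegree_pos
  haveI : Module.Finite (ZMod 7) (AdjoinRoot g) := (AdjoinRoot.powerBasis hg.ne_zero).finite
  haveI : Finite (AdjoinRoot g) := Module.finite_of_finite (ZMod 7)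
  haveI : Fintype (AdjoinRoot g) := Fintype.ofFinite _
  have hcard : Fintype.card (AdjoinRoot g) = 7 ^ g.natDegree := by
    rw [Module.card_eq_pow_finrank (K := ZMod 7), ZMod.card,
      (AdjoinRoot.powerBasis hg.ne_zero).finrank, AdjoinRoot.powerBasis_dim]
  have h7 : (7 : AdjoinRoot g) = 0 := by
    have := congrArg (algebraMap (ZMod 7) (AdjoinRoot g)) (show (7 : ZMod 7) = 0 from rfl)
    simpa only [map_ofNat, map_zero] using this
  have hroot : aeval (AdjoinRoot.root g) (rhoZ.map (Int.castRingHom (ZMod 7))) = 0 := by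
    obtain ⟨q, hq⟩ := hdvd
    rw [hq, map_mul, aeval_def, AdjoinRoot.algebraMap_eq, AdjoinRoot.eval₂_root, zero_mul]
  refine aux_key (AdjoinRoot.root g) h7 ?_ g.natDegree h1 h5 ?_
  · simp [rhoZ, _root_.map_ofNat] at hroot
    linear_combination hroot + ((-159130389)*(AdjoinRoot.root g)^0 + (7361809208)*(AdjoinRoot.root g)^1 + (-11187793420)*(AdjoinRoot.root g)^2 + (-36212793953)*(AdjoinRoot.root g)^3 + (36236883724)*(AdjoinRoot.root g)^4 + (74224980782)*(AdjoinRoot.root g)^5 + (-54565795666)*(AdjoinRoot.root g)^6 + (-61526475702)*(AdjoinRoot.root g)^7 + (39772646254)*(AdjoinRoot.root g)^8 + (17991841500)*(AdjoinRoot.root g)^9 + (-11828087076)*(AdjoinRoot.root g)^10)*h7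
  · rw [← hcard]; exact FiniteField.pow_card _

theorem aux_deg (A B : ℤ[X]) (h : rhoZ = A * B) (hA : 0 < A.natDegree) : 5 < A.natDegree := by
  have hl : A.leadingCoeff * B.leadingCoeff = 82796609536 := by
    rw [← leadingCoeff_mul, ← h, rhoZ_lead]
  have hA7 : Int.castRingHom (ZMod 7) A.leadingCoeff ≠ 0 := by
    intro h0
    have := congrArg (Int.castRingHom (ZMod 7)) hl
    rw [map_mul, h0, zero_mul] at this
    revert this
    decide
  have hdeg := natDegree_map_of_leadingCoeff_ne_zero (Int.castRingHom (ZMod 7)) hA7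
  have hne : A.map (Int.castRingHom (ZMod 7)) ≠ 0 := by
    intro h0; rw [h0, natDegree_zero] at hdeg; omega
  have hnu : ¬ IsUnit (A.map (Int.castRingHom (ZMod 7))) := by
    intro hu; have := natDegree_eq_zero_of_isUnit hu; omega
  obtain ⟨g, hg, hgd⟩ := WfDvdMonoid.exists_irreducible_factor hnu hne
  have h1 := aux_irr g hg (hgd.trans ⟨B.map _, by rw [h, Polynomial.map_mul]⟩)
  have h2 := natDegree_le_of_dvd hgd hne
  omega

theorem rhoZ_irr : Irreducible rhoZ := by
  have hconst : ∀ A B : ℤ[X], rhoZ = A * B → A.natDegree = 0 → IsUnit A := by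
    intro A B h h0
    rw [eq_C_of_natDegree_eq_zero h0] at h ⊢
    exact (rhoZ_prim _ ⟨B, h⟩).map C
  refine ⟨fun hu => ?_, fun A B h => ?_⟩
  · have := natDegree_eq_zero_of_isUnit hu
    rw [rhoZ_natDegree] at this; omega
  · by_contra! hc
    have hA : 0 < A.natDegree := by
      by_contra! h0; exact hc.1 (hconst A B h (by omega))
    have hB : 0 < B.natDegree := by
      by_contra! h0; exact hc.2 (hconst B A (by rw [h, mul_comm]) (by omega))
    have h1 := aux_deg A B h hA
    have h2 := aux_deg B A (by rw [h, mul_comm]) hB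
    have h3 := rhoZ_natDegree
    have hA0 : A ≠ 0 := by rintro rfl; simp at hA
    have hB0 : B ≠ 0 := by rintro rfl; simp at hB
    rw [h, natDegree_mul hA0 hB0] at h3
    omega

theorem rho_aeval (x : ℝ) : aeval x rhoPoly = (1113912729)*x^0 + (-51532664454)*x^1 + (78314553945)*x^2 + (253489557672)*x^3 + (-253658186064)*x^4 + (-519574865472)*x^5 + (381960569664)*x^6 + (430685329920)*x^7 + (-278408523776)*x^8 + (-125942890496)*x^9 + (82796609536)*x^10 := by
  simp [rhoPoly, _root_.map_ofNat]
  ring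

theorem rho_hasDeriv (x : ℝ) : HasDerivAt (fun x : ℝ => aeval x rhoPoly) ((-51532664454)*x^0 + (156629107890)*x^1 + (760468673016)*x^2 + (-1014632744256)*x^3 + (-2597874327360)*x^4 + (2291763417984)*x^5 + (3014797309440)*x^6 + (-2227268190208)*x^7 + (-1133486014464)*x^8 + (827966095360)*x^9) x := by
  have h := rhoPoly.hasDerivAt_aeval x
  have e : aeval x (derivative rhoPoly) = (-51532664454)*x^0 + (156629107890)*x^1 + (760468673016)*x^2 + (-1014632744256)*x^3 + (-2597874327360)*x^4 + (2291763417984)*x^5 + (3014797309440)*x^6 + (-2227268190208)*x^7 + (-1133486014464)*x^8 + (827966095360)*x^9 := by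
    simp [rhoPoly, _root_.map_ofNat, derivative_X_pow]
    ring
  rw [e] at h
  exact h

/-- `rhoPoly` is irreducible over `ℚ` and has exactly one
root `ρ` in the interval `(1/4, 1/2)`, which moreover satisfies
`0.415 < ρ < 0.4151`. -/
theorem rhoPoly_irreducible_and_unique_root :
    Irreducible rhoPoly ∧
    ∃ ρ : ℝ,
      (ρ ∈ Set.Ioo (1/4 : ℝ) (1/2) ∧ Polynomial.aeval ρ rhoPoly = 0 ∧
        ρ ∈ Set.Ioo (0.415 : ℝ) 0.4151) ∧
      ∀ ρ' : ℝ, ρ' ∈ Set.Ioo (1/4 : ℝ) (1/2) →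
        Polynomial.aeval ρ' rhoPoly = 0 → ρ' = ρ := by
  
  refine ⟨?_, ?_⟩
  · rw [← rhoZ_map]
    exact (IsPrimitive.Int.irreducible_iff_irreducible_map_cast rhoZ_prim).1 rhoZ_irr
  have hmono : StrictMonoOn (fun x : ℝ => aeval x rhoPoly) (Set.Icc (1/4 : ℝ) (1/2)) := by
    apply strictMonoOn_of_deriv_pos (convex_Icc _ _)
    · exact fun x _ => (rho_hasDeriv x).continuousAt.continuousWithinAt
    · intro x hx
      rw [interior_Icc] at hx
      rw [(rho_hasDeriv x).deriv]
      exact aux_deriv_pos x hx.1 hx.2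
  have hivt := intermediate_value_Ioo (a := (0.415 : ℝ)) (b := 0.4151) (by norm_num)
    (f := fun x : ℝ => aeval x rhoPoly)
    (fun x _ => (rho_hasDeriv x).continuousAt.continuousWithinAt)
  obtain ⟨r, hr, hr0⟩ := hivt (show (0:ℝ) ∈ _ from
    ⟨by simp only [rho_aeval]; norm_num, by simp only [rho_aeval]; norm_num⟩)
  have hr' : r ∈ Set.Ioo (1/4 : ℝ) (1/2) := by
    have := hr.1
    have := hr.2
    constructor <;> norm_num at * <;> linarith
  refine ⟨r, ⟨hr', hr0, hr⟩, fun s hs hs0 => ?_⟩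
  exact hmono.injOn (Set.Ioo_subset_Icc_self hs) (Set.Ioo_subset_Icc_self hr') (hs0.trans hr0.symm)
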